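/- Let G be a finite simple bipartite graph with bipartition (X, Y), let d be a positive integer and k > 1 an integer, and let f be an IASI of G such that f(x) is a d-AP-set with k ≤ |f(x)| for every x ∈ X, and f(y) is a (k·d)-AP-set for every y ∈ Y. Then every edge label f⁺(e) of G is a d-AP-set, and in the line graph L(G) with the induced labeling e ↦ f⁺(e), every vertex label and every edge label is a d-AP-set. -/

import Mathlib

open Pointwise

/-- A finite set of naturals is a `d`-AP-set if `d > 0`, it has at least 3 elements,
and its elements form an arithmetic progression with common difference `d`. -/
def IsAPSet (d : ℕ) (A : Finset ℕ) : Prop :=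
  0 < d ∧ 3 ≤ A.card ∧ ∃ a : ℕ, A = (Finset.range A.card).image (fun i => a + i * d)

/-- An integer additive set-indexer (IASI) of a simple graph `G`: an injective labeling of
vertices by nonempty finite sets of naturals whose induced edge labeling
`f⁺(uv) = f(u) + f(v)` (sumset) is injective on edges. -/
structure IsIASI {V : Type*} (G : SimpleGraph V) (f : V → Finset ℕ) : Prop where
  injective : Function.Injective f
  nonempty : ∀ v, (f v).Nonempty
  edgeInjective : ∀ ⦃u v x y : V⦄, G.Adj u v → G.Adj x y →
    f u + f v = f x + f y → s(u, v) = s(x, y)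

theorem isAPSet_of_eq_image {d n a : ℕ} {A : Finset ℕ} (hd : 0 < d) (hn : 3 ≤ n)
    (hA : A = (Finset.range n).image (fun i => a + i * d)) : IsAPSet d A := by
  have hcard : A.card = n := by
    rw [hA, Finset.card_image_of_injective, Finset.card_range]
    intro i j hij
    exact Nat.eq_of_mul_eq_mul_right hd (Nat.add_left_cancel hij)
  exact ⟨hd, by omega, a, by rw [hcard]; exact hA⟩

/-- Translates of an `m`-term progression by `n` multiples of `k ≤ m` steps leave no gaps. -/
theorem image_range_add_image_range (a b d : ℕ) {k m n : ℕ} (hk : 0 < k) (hkm : k ≤ m)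
    (hn : 0 < n) :
    (Finset.range m).image (fun i => a + i * d) +
        (Finset.range n).image (fun j => b + j * (k * d)) =
      (Finset.range (m + (n - 1) * k)).image (fun l => (a + b) + l * d) := by
  ext x
  simp only [Finset.mem_add, Finset.mem_image, Finset.mem_range]
  constructor
  · rintro ⟨_, ⟨i, hi, rfl⟩, _, ⟨j, hj, rfl⟩, rfl⟩
    have hjk : j * k ≤ (n - 1) * k := Nat.mul_le_mul_right k (by omega)
    exact ⟨i + j * k, by omega, by ring⟩
  · rintro ⟨l, hl, rfl⟩
    obtain ⟨i, j, hi, hj, rfl⟩ : ∃ i j, i < m ∧ j < n ∧ l = i + j * k := by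
      by_cases h : l < (n - 1) * k
      · refine ⟨l % k, l / k, (Nat.mod_lt l hk).trans_le hkm, ?_, (Nat.mod_add_div' l k).symm⟩
        have := (Nat.div_lt_iff_lt_mul hk).2 h
        omega
      · exact ⟨l - (n - 1) * k, n - 1, by omega, by omega, by omega⟩
    exact ⟨_, ⟨i, hi, rfl⟩, _, ⟨j, hj, rfl⟩, by ring⟩

theorem IsAPSet.add {d k : ℕ} {A B : Finset ℕ} (hA : IsAPSet d A) (hB : IsAPSet (k * d) B)
    (hk : k ≤ A.card) : IsAPSet d (A + B) := by
  obtain ⟨hd, hA3, a, hA⟩ := hA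
  obtain ⟨hkd, hB3, b, hB⟩ := hB
  have hsum := image_range_add_image_range a b d (Nat.pos_of_mul_pos_right hkd) hk
    (show 0 < B.card by omega)
  rw [← hA, ← hB] at hsum
  exact isAPSet_of_eq_image hd (by omega) hsum

/-- For a bipartite graph `G` with bipartition `(X, Xᶜ)`, an IASI `f` labeling each
`x ∈ X` by a `d`-AP-set of cardinality at least `k` and each `y ∉ X` by a `(k·d)`-AP-set:
every edge label of `G` is a `d`-AP-set, and in the line graph `L(G)` with the induced
labeling, every vertex label and every edge label is a `d`-AP-set. -/
theorem stmt9 {V : Type*} [Fintype V] (G : SimpleGraph V) (X : Set V)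
    (hbip : ∀ ⦃u v : V⦄, G.Adj u v → (u ∈ X ↔ v ∉ X))
    (d k : ℕ) (hk : 1 < k) (f : V → Finset ℕ) (hIASI : IsIASI G f)
    (hX : ∀ x ∈ X, IsAPSet d (f x) ∧ k ≤ (f x).card)
    (hY : ∀ y ∉ X, IsAPSet (k * d) (f y)) :
    (∀ u v, G.Adj u v → IsAPSet d (f u + f v)) ∧
    (∀ a b c, G.Adj a b → G.Adj b c → s(a, b) ≠ s(b, c) →
      IsAPSet d ((f a + f b) + (f b + f c))) := by
  have hedge : ∀ u v, G.Adj u v → IsAPSet d (f u + f v) := by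
    intro u v huv
    by_cases hu : u ∈ X
    · exact (hX u hu).1.add (hY v ((hbip huv).1 hu)) (hX u hu).2
    · have hv : v ∈ X := by
        by_contra hv
        exact hu ((hbip huv).2 hv)
      rw [add_comm]
      exact (hX v hv).1.add (hY u hu) (hX v hv).2
  refine ⟨hedge, fun a b c hab hbc _ => ?_⟩
  have h := hedge a b hab
  have hcard := h.2.1
  exact h.add (k := 1) (by rw [one_mul]; exact hedge b c hbc) (by omega)
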